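/- arXiv:1605.06033 — 3 statements merged into one kernel-verified Lean document; each statement's English description precedes it below -/
import Mathlib

section
/- The maximal dimension M(L) of a finite-dimensional simple L-module is divisible by p^2. -/
universe u v w

open Module

/-- `M(g)`: the supremum of the dimensions `dim_𝕜 V` over all finite-dimensional simple
`g`-modules `V`. -/
noncomputable def maxSimpleDim (𝕜 : Type u) [Field 𝕜] (g : Type v) [LieRing g]
    [LieAlgebra 𝕜 g] : ℕ :=
  sSup {n : ℕ | ∃ (V : Type (max u v)) (_ : AddCommGroup V) (_ : Module 𝕜 V)
      (_ : LieRingModule g V) (_ : LieModule 𝕜 g V),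
      FiniteDimensional 𝕜 V ∧ LieModule.IsIrreducible 𝕜 g V ∧ Module.finrank 𝕜 V = n}

/-- `b` is a basis of the Lie algebra `L` of the paper: `Sum.inl i ↦ x_{i+1}`
(for `i : Fin k`), `Sum.inr 0 ↦ D_0`, `Sum.inr 1 ↦ D`, where `D_0` is central, the `x_i`
commute, `[D, x_i] = x_i` for `i = 1, …, k-2`, `[D, x_{k-1}] = x_k` and `[D, x_k] = 0`. -/
def IsLBasis {𝕜 : Type u} [Field 𝕜] {L : Type v} [LieRing L] [LieAlgebra 𝕜 L]
    {k : ℕ} (b : Basis (Fin k ⊕ Fin 2) 𝕜 L) : Prop :=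
  (∀ i j : Fin k, ⁅b (Sum.inl i), b (Sum.inl j)⁆ = 0) ∧
  (∀ v : Fin k ⊕ Fin 2, ⁅b (Sum.inr 0), b v⁆ = 0) ∧
  (∀ i : Fin k, (i : ℕ) < k - 2 → ⁅b (Sum.inr 1), b (Sum.inl i)⁆ = b (Sum.inl i)) ∧
  (∀ i j : Fin k, (i : ℕ) = k - 2 → (j : ℕ) = k - 1 →
      ⁅b (Sum.inr 1), b (Sum.inl i)⁆ = b (Sum.inl j)) ∧
  (∀ i : Fin k, (i : ℕ) = k - 1 → ⁅b (Sum.inr 1), b (Sum.inl i)⁆ = 0)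

set_option linter.style.haveILetI false
set_option linter.unusedSectionVars false

namespace LAux

attribute [local instance] LieRing.ofAssociativeRing

theorem basis_ind {𝕜 : Type*} [Field 𝕜] {L : Type*} [AddCommGroup L] [Module 𝕜 L] {ι : Type*}
    (b : Basis ι 𝕜 L) {P : L → Prop} (l : L) (zero : P 0) (coe : ∀ i, P (b i))
    (hadd : ∀ a c, P a → P c → P (a + c)) (smul : ∀ (r : 𝕜) a, P a → P (r • a)) : P l := by
  refine Submodule.span_induction (p := fun x _ => P x) ?_ zero (fun x y _ _ => hadd x y)
    (fun r x _ => smul r x) (b.mem_span l)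
  rintro _ ⟨i, rfl⟩
  exact coe i

theorem common_eigenvector {𝕜 : Type*} [Field 𝕜] [IsAlgClosed 𝕜] {V : Type*} [AddCommGroup V]
    [Module 𝕜 V] [FiniteDimensional 𝕜 V] [Nontrivial V] {ι : Type*} (f : ι → End 𝕜 V)
    (hf : ∀ i j, Commute (f i) (f j)) (s : Finset ι) :
    ∃ W : Submodule 𝕜 V, W ≠ ⊥ ∧ (∀ i, ∀ x ∈ W, f i x ∈ W) ∧
      ∀ i ∈ s, ∃ c : 𝕜, ∀ x ∈ W, f i x = c • x := by
  classical
  induction s using Finset.induction_on with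
  | empty => exact ⟨⊤, top_ne_bot, by simp, by simp⟩
  | insert a s ha ih =>
    obtain ⟨W, hW, hinv, hs⟩ := ih
    haveI : Nontrivial W := Submodule.nontrivial_iff_ne_bot.2 hW
    obtain ⟨c, hc⟩ := Module.End.exists_eigenvalue ((f a).restrict (hinv a))
    obtain ⟨y, hy⟩ := hc.exists_hasEigenvector
    have hy1 : f a (y : V) = c • (y : V) := congrArg Subtype.val hy.apply_eq_smul
    have hy2 : (y : V) ≠ 0 := fun h => hy.2 (Subtype.ext h)
    refine ⟨W ⊓ LinearMap.ker (f a - c • (1 : End 𝕜 V)), ?_, ?_, ?_⟩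
    · intro h
      apply hy2
      have : (y : V) ∈ W ⊓ LinearMap.ker (f a - c • (1 : End 𝕜 V)) := by
        refine ⟨y.2, ?_⟩
        simp [hy1]
      rw [h] at this
      simpa using this
    · rintro i x ⟨hx1, hx2⟩
      refine ⟨hinv i x hx1, ?_⟩
      have hx3 : f a x = c • x := by
        have : f a x - c • x = 0 := by simpa using hx2
        exact sub_eq_zero.1 this
      have h4 : f a (f i x) = f i (f a x) := LinearMap.congr_fun (hf a i) x
      simp [h4, hx3]
    · intro i hi
      rcases Finset.mem_insert.1 hi with rfl | hi
      · refine ⟨c, ?_⟩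
        rintro x ⟨hx1, hx2⟩
        have : f i x - c • x = 0 := by simpa using hx2
        exact sub_eq_zero.1 this
      · obtain ⟨c', hc'⟩ := hs i hi
        exact ⟨c', fun x hx => hc' x hx.1⟩

theorem comm_of_weight {A : Type*} [Ring A] (p : ℕ) [Fact p.Prime] [CharP A p] (d x : A)
    (h : d * x - x * d = x) : Commute (d ^ p ^ 2 - d ^ p) x := by
  have h1 : SemiconjBy x (d + 1) d := by
    unfold SemiconjBy
    rw [mul_add, mul_one]
    exact (sub_eq_iff_eq_add'.1 h).symm
  have h2 := h1.pow_right p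
  have h3 := h1.pow_right (p ^ 2)
  rw [add_pow_char_of_commute p (Commute.one_right d), one_pow] at h2
  rw [add_pow_char_pow_of_commute p 2 (Commute.one_right d), one_pow] at h3
  unfold SemiconjBy at h2 h3
  unfold Commute SemiconjBy
  rw [sub_mul, ← h2, ← h3]
  noncomm_ring

theorem comm_of_jordan {A : Type*} [Ring A] (p : ℕ) [Fact p.Prime] [CharP A p] (d y z : A)
    (h : d * y - y * d = z) (hz : d * z - z * d = 0) : Commute (d ^ p ^ 2 - d ^ p) y := by
  have hz' : d * z = z * d := sub_eq_zero.1 hz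
  have h' : d * y = y * d + z := by rw [← h]; abel
  have key : ∀ n : ℕ, d ^ (n + 1) * y = y * d ^ (n + 1) + ((n + 1 : ℕ) : A) * (z * d ^ n) := by
    intro n
    induction n with
    | zero => simp [h']
    | succ n ih =>
      rw [pow_succ' d (n + 1), mul_assoc, ih, mul_add, ← mul_assoc d y, h',
        ← mul_assoc d, ← (Nat.cast_commute (n + 1) d).eq, mul_assoc _ d, ← mul_assoc d z, hz']
      push_cast
      rw [pow_succ' d n]
      noncomm_ring
  have hp := key (p - 1)
  have hp1 : p - 1 + 1 = p := Nat.succ_pred_prime (Fact.out)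
  rw [hp1, CharP.cast_eq_zero, zero_mul, add_zero] at hp
  have hc : Commute (d ^ p) y := hp
  have hc2 : Commute (d ^ p ^ 2) y := by
    rw [sq, pow_mul]
    exact hc.pow_left p
  exact hc2.sub_left hc

theorem upper {p k : ℕ} (hp : p.Prime) (hk : 3 ≤ k)
    {𝕜 : Type u} [Field 𝕜] [IsAlgClosed 𝕜] [CharP 𝕜 p]
    {L : Type v} [LieRing L] [LieAlgebra 𝕜 L]
    (b : Basis (Fin k ⊕ Fin 2) 𝕜 L) (hb : IsLBasis b)
    (V : Type w) [AddCommGroup V] [Module 𝕜 V] [LieRingModule L V] [LieModule 𝕜 L V]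
    [FiniteDimensional 𝕜 V] [LieModule.IsIrreducible 𝕜 L V] : finrank 𝕜 V ≤ p ^ 2 := by
  classical
  haveI : Fact p.Prime := ⟨hp⟩
  haveI : Nontrivial V := LieModule.nontrivial_of_isIrreducible 𝕜 L V
  haveI : CharP (End 𝕜 V) p :=
    charP_of_injective_algebraMap (FaithfulSMul.algebraMap_injective 𝕜 (End 𝕜 V)) p
  obtain ⟨h1, h2, h3, h4, h5⟩ := hb
  set φ := LieModule.toEnd 𝕜 L V with hφ
  set d : End 𝕜 V := φ (b (Sum.inr 1)) with hd
  set e : End 𝕜 V := φ (b (Sum.inr 0)) with he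
  set x : Fin k → End 𝕜 V := fun i => φ (b (Sum.inl i)) with hx
  have br : ∀ a c : L, φ a * φ c - φ c * φ a = φ ⁅a, c⁆ := by
    intro a c
    rw [LieHom.map_lie, Ring.lie_def]
  have xx : ∀ i j, Commute (x i) (x j) := by
    intro i j
    have := br (b (Sum.inl i)) (b (Sum.inl j))
    rw [h1, map_zero] at this
    exact sub_eq_zero.1 this
  have ee : ∀ i, Commute e (φ (b i)) := by
    intro i
    have := br (b (Sum.inr 0)) (b i)
    rw [h2, map_zero] at this
    exact sub_eq_zero.1 this
  have k2 : k - 2 < k := by omega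
  have k1 : k - 1 < k := by omega
  have dx : ∀ i : Fin k, d * x i - x i * d = x i ∨ d * x i - x i * d = 0 ∨
      (∃ j, d * x i - x i * d = x j ∧ d * x j - x j * d = 0) := by
    intro i
    have hi := br (b (Sum.inr 1)) (b (Sum.inl i))
    by_cases c1 : (i : ℕ) < k - 2
    · rw [h3 i c1] at hi
      exact Or.inl hi
    by_cases c2 : (i : ℕ) = k - 2
    · right; right
      refine ⟨⟨k - 1, k1⟩, ?_, ?_⟩
      · rw [h4 i ⟨k - 1, k1⟩ c2 rfl] at hi
        exact hi
      · have hj := br (b (Sum.inr 1)) (b (Sum.inl ⟨k - 1, k1⟩))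
        rw [h5 _ rfl, map_zero] at hj
        exact hj
    · right; left
      rw [h5 i (by omega), map_zero] at hi
      exact hi
  set z : End 𝕜 V := d ^ p ^ 2 - d ^ p with hz
  have zx : ∀ i, Commute z (x i) := by
    intro i
    rcases dx i with h | h | ⟨j, h, h'⟩
    · exact comm_of_weight p d _ h
    · exact comm_of_jordan p d _ 0 h (by simp)
    · exact comm_of_jordan p d _ _ h h'
  have ez : Commute e z := by
    have : Commute e d := ee (Sum.inr 1)
    exact (this.pow_right _).sub_right (this.pow_right _)
  let f : Option (Option (Fin k)) → End 𝕜 V := fun o =>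
    match o with
    | none => z
    | some none => e
    | some (some i) => x i
  have hf : ∀ i j, Commute (f i) (f j) := by
    rintro (_ | _ | i) (_ | _ | j)
    · exact Commute.refl _
    · exact ez.symm
    · exact zx j
    · exact ez
    · exact Commute.refl _
    · exact ee _
    · exact (zx i).symm
    · exact (ee _).symm
    · exact xx i j
  obtain ⟨W0, hW0, -, hW1⟩ := common_eigenvector f hf Finset.univ
  obtain ⟨v, hv, hv0⟩ := Submodule.exists_mem_ne_zero_of_ne_bot hW0
  obtain ⟨cz, hcz⟩ := hW1 none (Finset.mem_univ _)
  obtain ⟨ce, hce⟩ := hW1 (some none) (Finset.mem_univ _)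
  have hcx : ∀ i, ∃ c : 𝕜, x i v = c • v := by
    intro i
    obtain ⟨c, hc⟩ := hW1 (some (some i)) (Finset.mem_univ _)
    exact ⟨c, hc v hv⟩
  have hzv : z v = cz • v := hcz v hv
  have hev : e v = ce • v := hce v hv
  let g : Fin (p ^ 2) → V := fun n => (d ^ (n : ℕ)) v
  let W : Submodule 𝕜 V := Submodule.span 𝕜 (Set.range g)
  have hlt : p < p ^ 2 := by
    have := hp.two_le
    nlinarith
  have gm : ∀ n, n < p ^ 2 → (d ^ n) v ∈ W := fun n hn => Submodule.subset_span ⟨⟨n, hn⟩, rfl⟩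
  have vW : v ∈ W := by simpa using gm 0 (pow_pos hp.pos 2)
  have invOf : ∀ T : End 𝕜 V, (∀ n, n < p ^ 2 → T ((d ^ n) v) ∈ W) → ∀ y ∈ W, T y ∈ W := by
    intro T hT
    have : W ≤ W.comap T := by
      refine Submodule.span_le.2 ?_
      rintro _ ⟨n, rfl⟩
      exact hT n n.2
    exact this
  have dW : ∀ y ∈ W, d y ∈ W := by
    apply invOf
    intro n hn
    rw [← Module.End.mul_apply, ← pow_succ']
    rcases Nat.lt_or_ge (n + 1) (p ^ 2) with h | h
    · exact gm _ h
    · have h6 : n + 1 = p ^ 2 := by omega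
      have h7 : d ^ (n + 1) = z + d ^ p := by rw [h6, hz]; abel
      rw [h7, LinearMap.add_apply, hzv]
      exact W.add_mem (W.smul_mem _ vW) (gm p hlt)
  have gm' : ∀ n, (d ^ n) v ∈ W := by
    intro n
    induction n with
    | zero => simpa using vW
    | succ n ih =>
      rw [pow_succ', Module.End.mul_apply]
      exact dW _ ih
  have xW' : ∀ n i, x i ((d ^ n) v) ∈ W := by
    intro n
    induction n with
    | zero =>
      intro i
      obtain ⟨c, hc⟩ := hcx i
      simp only [pow_zero, Module.End.one_apply, hc]
      exact W.smul_mem _ vW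
    | succ n ih =>
      intro i
      have h6 : x i ((d ^ (n + 1)) v) =
          d (x i ((d ^ n) v)) - (d * x i - x i * d) ((d ^ n) v) := by
        rw [pow_succ']
        simp
      rw [h6]
      refine W.sub_mem (dW _ (ih i)) ?_
      rcases dx i with h | h | ⟨j, h, -⟩
      · rw [h]; exact ih i
      · rw [h]; simp
      · rw [h]; exact ih j
  have xW : ∀ i, ∀ y ∈ W, x i y ∈ W := fun i => invOf _ fun n _ => xW' n i
  have eW : ∀ y ∈ W, e y ∈ W := by
    apply invOf
    intro n _
    have : Commute e (d ^ n) := (ee (Sum.inr 1)).pow_right n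
    have h6 : e ((d ^ n) v) = (d ^ n) (e v) := LinearMap.congr_fun this v
    rw [h6, hev, map_smul]
    exact W.smul_mem _ (gm' n)
  have bW : ∀ i, ∀ y ∈ W, φ (b i) y ∈ W := by
    rintro (i | i)
    · exact xW i
    · fin_cases i
      · exact eW
      · exact dW
  have lW : ∀ (l : L), ∀ y ∈ W, φ l y ∈ W := by
    intro l y hy
    induction l using basis_ind b with
    | zero => simp
    | coe i => exact bW i y hy
    | hadd a c ha hc => rw [map_add]; exact W.add_mem ha hc
    | smul r a ha => rw [map_smul]; exact W.smul_mem _ ha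
  let N : LieSubmodule 𝕜 L V := { W with lie_mem := fun {l y} hy => lW l y hy }
  have hN : N = ⊤ := by
    refine (IsSimpleOrder.eq_bot_or_eq_top N).resolve_left ?_
    intro h
    have : v ∈ N := vW
    rw [h] at this
    exact hv0 (by simpa using this)
  have hWt : W = ⊤ := by
    rw [eq_top_iff]
    intro y _
    have : y ∈ N := by rw [hN]; trivial
    exact this
  calc finrank 𝕜 V = finrank 𝕜 W := by rw [hWt, finrank_top]
    _ ≤ Fintype.card (Fin (p ^ 2)) := finrank_range_le_card g
    _ = p ^ 2 := Fintype.card_fin _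

section construction

variable {𝕜 : Type u} [Field 𝕜] {R : Type w} [CommRing R] (c : R →+* 𝕜)

/-- shift in the first variable -/
def opX (𝕜 : Type u) [Field 𝕜] (R : Type w) [CommRing R] : End 𝕜 (R × R → 𝕜) where
  toFun f := fun r => f (r.1 - 1, r.2)
  map_add' _ _ := rfl
  map_smul' _ _ := rfl

/-- shift in the second variable -/
def opS (𝕜 : Type u) [Field 𝕜] (R : Type w) [CommRing R] : End 𝕜 (R × R → 𝕜) where
  toFun f := fun r => f (r.1, r.2 + 1)
  map_add' _ _ := rfl
  map_smul' _ _ := rfl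

/-- multiplication by a function -/
def opM (h : R × R → 𝕜) : End 𝕜 (R × R → 𝕜) where
  toFun f := h * f
  map_add' _ _ := mul_add _ _ _
  map_smul' _ _ := mul_smul_comm _ _ _

/-- the image of `x_{k-1}` -/
def opY : End 𝕜 (R × R → 𝕜) where
  toFun f := fun r => c r.2 * f (r.1, r.2 - 1)
  map_add' _ _ := by ext; simp [mul_add]
  map_smul' _ _ := by ext; simp; ring

/-- the image of `D` -/
def opD : End 𝕜 (R × R → 𝕜) := opM (fun r => c r.1) + opS 𝕜 R

theorem lie_DX : ⁅opD c, opX 𝕜 R⁆ = opX 𝕜 R := by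
  ext f r
  simp [Ring.lie_def, opD, opX, opM, opS]
  ring

theorem lie_DY : ⁅opD c, opY c⁆ = 1 := by
  refine LinearMap.ext fun f => funext fun r => ?_
  simp [Ring.lie_def, opD, opY, opM, opS]
  ring

theorem lie_XY : ⁅opX 𝕜 R, opY c⁆ = 0 := by
  refine LinearMap.ext fun f => funext fun r => ?_
  simp [Ring.lie_def, opY, opX]

/-- values on the basis -/
def val (k : ℕ) : Fin k ⊕ Fin 2 → End 𝕜 (R × R → 𝕜)
  | Sum.inl i => if (i : ℕ) < k - 2 then opX 𝕜 R else if (i : ℕ) = k - 2 then opY c else 1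
  | Sum.inr i => if i = 0 then 0 else opD c

variable {L : Type v} [LieRing L] [LieAlgebra 𝕜 L]

theorem lie_one_right' {A : Type*} [Ring A] (a : A) : ⁅a, (1 : A)⁆ = 0 := by
  simp [Ring.lie_def]

theorem lie_one_left' {A : Type*} [Ring A] (a : A) : ⁅(1 : A), a⁆ = 0 := by
  simp [Ring.lie_def]

theorem rep_basis {k : ℕ} (hk : 3 ≤ k) (b : Basis (Fin k ⊕ Fin 2) 𝕜 L) (hb : IsLBasis b)
    (i j : Fin k ⊕ Fin 2) :
    b.constr 𝕜 (val c k) ⁅b i, b j⁆ = ⁅val c k i, val c k j⁆ := by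
  obtain ⟨h1, h2, h3, h4, h5⟩ := hb
  have hDx : ∀ i : Fin k, b.constr 𝕜 (val c k) ⁅b (Sum.inr 1), b (Sum.inl i)⁆ =
      ⁅val c k (Sum.inr 1), val c k (Sum.inl i)⁆ := by
    intro i
    by_cases c1 : (i : ℕ) < k - 2
    · rw [h3 i c1, Basis.constr_basis]
      simp [val, c1, lie_DX]
    by_cases c2 : (i : ℕ) = k - 2
    · rw [h4 i ⟨k - 1, by omega⟩ c2 rfl, Basis.constr_basis]
      have e1 : ¬ (k - 1 < k - 2) := by omega
      have e2 : ¬ (k - 1 = k - 2) := by omega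
      simp [val, c2, lie_DY, e1, e2]
    · rw [h5 i (by omega), map_zero]
      simp [val, c1, c2, lie_one_right']
  rcases i with i | i <;> rcases j with j | j
  · rw [h1, map_zero]
    have hYX : ⁅opY c, opX 𝕜 R⁆ = 0 := by rw [← lie_skew, lie_XY, neg_zero]
    simp only [val]
    split_ifs <;> simp [lie_XY, hYX, lie_one_right', lie_one_left']
  · obtain rfl | rfl : j = 0 ∨ j = 1 := by omega
    · rw [← lie_skew, h2]
      simp [val]
    · rw [← lie_skew, map_neg, hDx, lie_skew]
  · obtain rfl | rfl : i = 0 ∨ i = 1 := by omega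
    · rw [h2]
      simp [val]
    · exact hDx j
  · obtain rfl | rfl : i = 0 ∨ i = 1 := by omega
    · rw [h2]
      simp [val]
    · obtain rfl | rfl : j = 0 ∨ j = 1 := by omega
      · rw [← lie_skew, h2]
        simp [val]
      · simp

/-- the representation -/
noncomputable def rep {k : ℕ} (hk : 3 ≤ k) (b : Basis (Fin k ⊕ Fin 2) 𝕜 L) (hb : IsLBasis b) :
    L →ₗ⁅𝕜⁆ End 𝕜 (R × R → 𝕜) :=
  { b.constr 𝕜 (val c k) with
    map_lie' := by
      intro x y
      change b.constr 𝕜 (val c k) ⁅x, y⁆ =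
        ⁅b.constr 𝕜 (val c k) x, b.constr 𝕜 (val c k) y⁆
      induction x using basis_ind b with
      | zero => simp
      | hadd a a' ha ha' => rw [add_lie, map_add, map_add, add_lie, ha, ha']
      | smul r a ha => rw [smul_lie, map_smul, map_smul, ha, Ring.lie_def, Ring.lie_def, smul_mul_assoc, mul_smul_comm, smul_sub]
      | coe i =>
        induction y using basis_ind b with
        | zero => simp
        | hadd a a' ha ha' => rw [lie_add, map_add, map_add, lie_add, ha, ha']
        | smul r a ha => rw [lie_smul, map_smul, map_smul, ha, Ring.lie_def, Ring.lie_def, smul_mul_assoc, mul_smul_comm, smul_sub]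
        | coe j => rw [rep_basis c hk b hb, Basis.constr_basis, Basis.constr_basis] }

theorem rep_apply {k : ℕ} (hk : 3 ≤ k) (b : Basis (Fin k ⊕ Fin 2) 𝕜 L) (hb : IsLBasis b)
    (i : Fin k ⊕ Fin 2) : rep c hk b hb (b i) = val c k i :=
  Basis.constr_basis b 𝕜 (val c k) i

theorem opS_pow (n : ℕ) (f : R × R → 𝕜) (r : R × R) :
    ((opS 𝕜 R) ^ n) f r = f (r.1, r.2 + n) := by
  induction n generalizing f with
  | zero => simp
  | succ n ih =>
    rw [pow_succ, Module.End.mul_apply, ih]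
    simp [opS, add_assoc]

theorem opX_pow (n : ℕ) (f : R × R → 𝕜) (r : R × R) :
    ((opX 𝕜 R) ^ n) f r = f (r.1 - n, r.2) := by
  induction n generalizing f with
  | zero => simp
  | succ n ih =>
    rw [pow_succ, Module.End.mul_apply, ih]
    simp [opX, sub_sub]

theorem opM_pow (h : R × R → 𝕜) (n : ℕ) : (opM h) ^ n = opM (h ^ n) := by
  induction n with
  | zero => refine LinearMap.ext fun f => ?_; simp [opM]
  | succ n ih =>
    rw [pow_succ, ih]
    refine LinearMap.ext fun f => ?_
    simp [opM, pow_succ, mul_assoc]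

theorem irred {p : ℕ} [hp : Fact p.Prime] [CharP 𝕜 p] (hc : Function.Injective c)
    (hR : ∀ r : R, ∃ n : ℕ, (n : R) = r) [Fintype R]
    (W : Submodule 𝕜 (R × R → 𝕜)) (hW : W ≠ ⊥)
    (WX : ∀ f ∈ W, opX 𝕜 R f ∈ W) (WY : ∀ f ∈ W, opY c f ∈ W) (WD : ∀ f ∈ W, opD c f ∈ W) :
    W = ⊤ := by
  classical
  have powW : ∀ (T : End 𝕜 (R × R → 𝕜)), (∀ f ∈ W, T f ∈ W) → ∀ n : ℕ, ∀ f ∈ W,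
      (T ^ n) f ∈ W := by
    intro T hT n
    induction n with
    | zero => intro f hf; simpa using hf
    | succ n ih => intro f hf; rw [pow_succ, Module.End.mul_apply]; exact ih _ (hT f hf)
  have hRp : (p : R) = 0 := hc (by simp)
  have cp : ∀ r : R, c r ^ p = c r := by
    intro r
    obtain ⟨n, rfl⟩ := hR r
    rw [map_natCast]
    exact map_natCast (frobenius 𝕜 p) n
  haveI : CharP (End 𝕜 (R × R → 𝕜)) p :=
    charP_of_injective_algebraMap (FaithfulSMul.algebraMap_injective 𝕜 (End 𝕜 (R × R → 𝕜))) p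
  have hcomm : Commute (opM fun r : R × R => c r.1) (opS 𝕜 R) := by
    refine LinearMap.ext fun f => funext fun r => ?_
    simp [opM, opS]
  have hDp : (opD c) ^ p = opM (fun r => c r.1) + 1 := by
    rw [opD, add_pow_char_of_commute p hcomm]
    congr 1
    · rw [opM_pow]
      congr 1
      funext r
      exact cp _
    · refine LinearMap.ext fun f => funext fun r => ?_
      rw [opS_pow, hRp]
      simp
  have WA : ∀ f ∈ W, opM (fun r => c r.1) f ∈ W := by
    intro f hf
    have := W.sub_mem (powW _ WD p f hf) hf
    rw [hDp] at this
    simpa using this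
  have WS : ∀ f ∈ W, opS 𝕜 R f ∈ W := by
    intro f hf
    have := W.sub_mem (WD f hf) (WA f hf)
    simpa [opD] using this
  have WB : ∀ f ∈ W, opM (fun r => c r.2) f ∈ W := by
    intro f hf
    have := WY _ (WS f hf)
    convert this using 1
    funext r
    simp [opM, opY, opS]
  have ind : ∀ h : R × R → R, (∀ f ∈ W, opM (fun r => c (h r)) f ∈ W) → ∀ a : R, ∀ f ∈ W,
      (fun r => if h r = a then f r else 0) ∈ W := by
    intro h hh a f hf
    have h1 : ∀ f ∈ W, opM (fun r => c (h r) - c a) f ∈ W := by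
      intro f hf
      have := W.sub_mem (hh f hf) (W.smul_mem (c a) hf)
      convert this using 1
      funext r
      simp [opM, sub_mul]
    have h2 := W.sub_mem hf (powW _ h1 (p - 1) f hf)
    convert h2 using 1
    funext r
    rw [opM_pow]
    simp only [opM, LinearMap.coe_mk, AddHom.coe_mk, Pi.sub_apply, Pi.mul_apply, Pi.pow_apply]
    split_ifs with hr
    · have : p - 1 ≠ 0 := by have := hp.out.two_le; omega
      simp [hr, this]
    · have hne : c (h r - a) ≠ 0 := by
        intro h0
        exact hr (sub_eq_zero.1 (hc (by rw [h0, map_zero])))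
      have h3 : c (h r - a) ^ (p - 1) = 1 := by
        apply mul_right_cancel₀ hne
        rw [← pow_succ, Nat.sub_add_cancel hp.out.one_le, cp, one_mul]
      rw [← map_sub, h3]
      simp
  obtain ⟨f, hf, hf0⟩ := Submodule.exists_mem_ne_zero_of_ne_bot hW
  obtain ⟨⟨a, b⟩, hab⟩ := Function.ne_iff.1 hf0
  have hab' : f (a, b) ≠ 0 := hab
  have hδ : (Pi.single (a, b) 1 : R × R → 𝕜) ∈ W := by
    have := W.smul_mem (f (a, b))⁻¹ (ind Prod.snd WB b _ (ind Prod.fst WA a f hf))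
    convert this using 1
    funext ⟨r, s⟩
    by_cases hr : r = a <;> by_cases hs : s = b <;> simp [hr, hs, hab']
  have hall : ∀ q : R × R, (Pi.single q 1 : R × R → 𝕜) ∈ W := by
    rintro ⟨r, s⟩
    obtain ⟨n, hn⟩ := hR (r - a)
    obtain ⟨m, hm⟩ := hR (b - s)
    have := powW _ WS m _ (powW _ WX n _ hδ)
    convert this using 1
    funext ⟨t, u⟩
    rw [opS_pow, opX_pow, hn, hm]
    simp only [Pi.single_apply, Prod.mk.injEq]
    congr 1
    apply propext
    constructor
    · rintro ⟨rfl, rfl⟩; constructor <;> ring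
    · rintro ⟨h1, h2⟩
      constructor
      · linear_combination h1
      · linear_combination h2
  rw [eq_top_iff]
  intro g _
  rw [← Finset.univ_sum_single g]
  refine W.sum_mem fun q _ => ?_
  have := W.smul_mem (g q) (hall q)
  rwa [← Pi.single_smul, smul_eq_mul, mul_one] at this

end construction

theorem lower {p k : ℕ} (hp : p.Prime) (hk : 3 ≤ k)
    {𝕜 : Type u} [Field 𝕜] [CharP 𝕜 p]
    {L : Type v} [LieRing L] [LieAlgebra 𝕜 L]
    (b : Basis (Fin k ⊕ Fin 2) 𝕜 L) (hb : IsLBasis b) :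
    ∃ (V : Type (max u v)) (_ : AddCommGroup V) (_ : Module 𝕜 V)
      (_ : LieRingModule L V) (_ : LieModule 𝕜 L V),
      FiniteDimensional 𝕜 V ∧ LieModule.IsIrreducible 𝕜 L V ∧ Module.finrank 𝕜 V = p ^ 2 := by
  haveI : Fact p.Prime := ⟨hp⟩
  let R := ULift.{v} (ZMod p)
  let c : R →+* 𝕜 := (ZMod.castHom (dvd_refl p) 𝕜).comp (ULift.ringEquiv (R := ZMod p)).toRingHom
  haveI : Fintype R := inferInstanceAs (Fintype (ULift (ZMod p)))
  have hc : Function.Injective c :=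
    (RingHom.injective (ZMod.castHom (dvd_refl p) 𝕜)).comp (ULift.ringEquiv (R := ZMod p)).injective
  have hR : ∀ r : R, ∃ n : ℕ, (n : R) = r := by
    rintro ⟨r⟩
    exact ⟨r.val, ULift.ext _ _ (ZMod.natCast_zmod_val r)⟩
  let ρ := rep c hk b hb
  letI i1 : LieRingModule L (R × R → 𝕜) := LieRingModule.compLieHom (R × R → 𝕜) ρ
  letI i2 : LieModule 𝕜 L (R × R → 𝕜) := LieModule.compLieHom (R × R → 𝕜) ρ
  have act : ∀ (i) (f : R × R → 𝕜), ⁅b i, f⁆ = val c k i f := by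
    intro i f
    have : ⁅b i, f⁆ = ρ (b i) f := rfl
    rw [this, rep_apply]
  refine ⟨R × R → 𝕜, inferInstance, inferInstance, i1, i2, inferInstance, ?_, ?_⟩
  · haveI : Nontrivial (R × R → 𝕜) := inferInstance
    refine LieModule.IsIrreducible.mk fun N hN => ?_
    have : (N : Submodule 𝕜 (R × R → 𝕜)) = ⊤ := by
      refine irred (p := p) c hc hR _ (by simpa using hN) ?_ ?_ ?_
      · intro f hf
        have := N.lie_mem (x := b (Sum.inl ⟨0, by omega⟩)) hf
        have e1 : 0 < k - 2 := by omega
        rw [act] at this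
        simp only [val, e1, if_true] at this
        exact this
      · intro f hf
        have := N.lie_mem (x := b (Sum.inl ⟨k - 2, by omega⟩)) hf
        rw [act] at this
        simp only [val, lt_irrefl, if_true, if_false] at this
        exact this
      · intro f hf
        have := N.lie_mem (x := b (Sum.inr 1)) hf
        rw [act] at this
        simpa [val] using this
    simpa using this
  · rw [Module.finrank_fintype_fun_eq_card, Fintype.card_prod, sq]
    have : Fintype.card R = p := by
      rw [← Nat.card_eq_fintype_card, Nat.card_congr (Equiv.ulift : R ≃ ZMod p), Nat.card_zmod]
    rw [this]

end LAux

/-- `p ^ 2` divides `M(L)`, the maximal dimension of a finite-dimensional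
simple `L`-module. -/
theorem stmt0 (p k : ℕ) (hp : p.Prime) (hk : 3 ≤ k)
    (𝕜 : Type u) [Field 𝕜] [IsAlgClosed 𝕜] [CharP 𝕜 p]
    (L : Type v) [LieRing L] [LieAlgebra 𝕜 L]
    (b : Basis (Fin k ⊕ Fin 2) 𝕜 L) (hb : IsLBasis b) :
    p ^ 2 ∣ maxSimpleDim 𝕜 L := by
  have h : maxSimpleDim 𝕜 L = p ^ 2 := by
    refine IsGreatest.csSup_eq ⟨LAux.lower hp hk b hb, ?_⟩
    rintro n ⟨V, _, _, _, _, h1, h2, rfl⟩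
    exact LAux.upper hp hk b hb V
  rw [h]
end

section
/- The derived subalgebra [L', L'] equals the linear span of x_1, x_2, …, x_{k−2}, x_k. -/
universe u v w

open Module

/-- `b` is a basis of the Lie algebra `L'` of the paper: `Sum.inl i ↦ x_{i+1}`
(for `i : Fin k`), `Sum.inr 0 ↦ D`, `Sum.inr 1 ↦ D'`, where the `x_i` commute,
`[D, D'] = 0`, `[D, x_i] = [D', x_i] = x_i` for `i = 1, …, k-2`, `[D, x_{k-1}] = x_k`,
`[D', x_{k-1}] = 0` and `[D, x_k] = [D', x_k] = 0`. -/
def IsL'Basis {𝕜 : Type u} [Field 𝕜] {L' : Type v} [LieRing L'] [LieAlgebra 𝕜 L']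
    {k : ℕ} (b : Basis (Fin k ⊕ Fin 2) 𝕜 L') : Prop :=
  (∀ i j : Fin k, ⁅b (Sum.inl i), b (Sum.inl j)⁆ = 0) ∧
  (⁅b (Sum.inr 0), b (Sum.inr 1)⁆ = 0) ∧
  (∀ i : Fin k, (i : ℕ) < k - 2 →
      ⁅b (Sum.inr 0), b (Sum.inl i)⁆ = b (Sum.inl i) ∧
      ⁅b (Sum.inr 1), b (Sum.inl i)⁆ = b (Sum.inl i)) ∧
  (∀ i j : Fin k, (i : ℕ) = k - 2 → (j : ℕ) = k - 1 →
      ⁅b (Sum.inr 0), b (Sum.inl i)⁆ = b (Sum.inl j) ∧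
      ⁅b (Sum.inr 1), b (Sum.inl i)⁆ = 0) ∧
  (∀ i : Fin k, (i : ℕ) = k - 1 →
      ⁅b (Sum.inr 0), b (Sum.inl i)⁆ = 0 ∧ ⁅b (Sum.inr 1), b (Sum.inl i)⁆ = 0)

/-- the derived subalgebra `[L', L']` equals the span of
`x_1, …, x_{k-2}, x_k` (i.e. of the `x_i` with `i ≠ k - 1`, in the indexing of the paper). -/
theorem stmt7 (p k : ℕ) (hp : p.Prime) (hk : 3 ≤ k)
    (𝕜 : Type u) [Field 𝕜] [IsAlgClosed 𝕜] [CharP 𝕜 p]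
    (L' : Type v) [LieRing L'] [LieAlgebra 𝕜 L']
    (b : Basis (Fin k ⊕ Fin 2) 𝕜 L') (hb : IsL'Basis b) :
    ((⁅(⊤ : LieIdeal 𝕜 L'), (⊤ : LieIdeal 𝕜 L')⁆ : LieIdeal 𝕜 L') : Submodule 𝕜 L')
      = Submodule.span 𝕜 {y : L' | ∃ i : Fin k, (i : ℕ) ≠ k - 2 ∧ y = b (Sum.inl i)} := by
  obtain ⟨h1, h2, h3, h4, h5⟩ := hb
  change (⁅(⊤ : LieIdeal 𝕜 L'), (⊤ : LieIdeal 𝕜 L')⁆ : LieIdeal 𝕜 L').toSubmodule = _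
  rw [LieSubmodule.lieIdeal_oper_eq_linear_span']
  set S : Submodule 𝕜 L' :=
    Submodule.span 𝕜 {y : L' | ∃ i : Fin k, (i : ℕ) ≠ k - 2 ∧ y = b (Sum.inl i)} with hS
  apply le_antisymm
  · have hDx : ∀ (d : Fin 2) (i : Fin k), ⁅b (Sum.inr d), b (Sum.inl i)⁆ ∈ S := by
      intro d i
      have hi := i.2
      rcases lt_trichotomy (i : ℕ) (k - 2) with h | h | h
      · have hm : b (Sum.inl i) ∈ S := Submodule.subset_span ⟨i, h.ne, rfl⟩
        fin_cases d
        · simpa [(h3 i h).1] using hm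
        · simpa [(h3 i h).2] using hm
      · have hj := h4 i ⟨k - 1, by omega⟩ h rfl
        have hm : b (Sum.inl (⟨k - 1, by omega⟩ : Fin k)) ∈ S :=
          Submodule.subset_span ⟨_, by simp only; omega, rfl⟩
        fin_cases d
        · simpa [hj.1] using hm
        · simp [hj.2]
      · have hj := h5 i (by omega)
        fin_cases d
        · simp [hj.1]
        · simp [hj.2]
    have hbb : ∀ s t, ⁅b s, b t⁆ ∈ S := by
      rintro (i | d) (j | e)
      · simp [h1]
      · rw [← lie_skew]
        exact S.neg_mem (hDx e i)
      · exact hDx d j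
      · have h2' : ⁅b (Sum.inr 1), b (Sum.inr 0)⁆ = 0 := by rw [← lie_skew, h2, neg_zero]
        fin_cases d <;> fin_cases e <;> simp [h2, h2']
    rw [Submodule.span_le]
    rintro _ ⟨x, -, y, -, rfl⟩
    have hx : ∀ t, ⁅x, b t⁆ ∈ S := by
      intro t
      rw [← b.sum_repr x, sum_lie]
      refine S.sum_mem fun s _ => ?_
      rw [smul_lie]
      exact S.smul_mem _ (hbb s t)
    change ⁅x, y⁆ ∈ S
    rw [← b.sum_repr y, lie_sum]
    refine S.sum_mem fun t _ => ?_
    rw [lie_smul]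
    exact S.smul_mem _ (hx t)
  · rw [hS, Submodule.span_le]
    rintro _ ⟨i, hi, rfl⟩
    apply Submodule.subset_span
    have := i.2
    by_cases h : (i : ℕ) < k - 2
    · exact ⟨_, trivial, _, trivial, (h3 i h).1⟩
    · exact ⟨_, trivial, _, trivial, (h4 ⟨k - 2, by omega⟩ i rfl (by omega)).1⟩
end

section
/- Let g and h be finite-dimensional Lie algebras over a field 𝕜 with dim g = dim h. Then every surjective 𝕜-algebra homomorphism U(g) → U(h) between their universal enveloping algebras is injective, hence an isomorphism. -/
universe u v w

open Module

namespace PBW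

open MvPolynomial

section Poly

variable (𝕜 : Type u) [Field 𝕜] (n : ℕ)

/-- the monomial with exponent `s` -/
noncomputable def z (s : Fin n →₀ ℕ) : MvPolynomial (Fin n) 𝕜 := monomial s 1

/-- polynomials of degree `< k` -/
noncomputable def W (k : ℕ) : Submodule 𝕜 (MvPolynomial (Fin n) 𝕜) :=
  restrictSupport 𝕜 {s | s.degree < k}

variable {𝕜 n}

theorem mem_W {k : ℕ} {f : MvPolynomial (Fin n) 𝕜} :
    f ∈ W 𝕜 n k ↔ ∀ s ∈ f.support, s.degree < k := Iff.rfl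

theorem z_mem_W {k : ℕ} {s : Fin n →₀ ℕ} (h : s.degree < k) : z 𝕜 n s ∈ W 𝕜 n k := by
  unfold W z
  rw [monomial_mem_restrictSupport]
  exact Or.inl h

theorem W_le {k : ℕ} {P : Submodule 𝕜 (MvPolynomial (Fin n) 𝕜)}
    (h : ∀ s : Fin n →₀ ℕ, s.degree < k → z 𝕜 n s ∈ P) : W 𝕜 n k ≤ P := by
  unfold W
  rw [restrictSupport_eq_span, Submodule.span_le]
  rintro _ ⟨s, hs, rfl⟩
  exact h s hs

theorem W_mono {k l : ℕ} (h : k ≤ l) : W 𝕜 n k ≤ W 𝕜 n l :=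
  W_le fun _ hs => z_mem_W (hs.trans_le h)

theorem mem_W_totalDegree (f : MvPolynomial (Fin n) 𝕜) : f ∈ W 𝕜 n (f.totalDegree + 1) := by
  rw [mem_W]
  intro s hs
  exact Nat.lt_succ_of_le (le_totalDegree hs)

theorem totalDegree_lt_of_mem_W {f : MvPolynomial (Fin n) 𝕜} {k : ℕ} (hf : f ∈ W 𝕜 n k)
    (h0 : f ≠ 0) : f.totalDegree < k := by
  rw [mem_W] at hf
  obtain ⟨s, hs, h⟩ := Finset.exists_mem_eq_sup f.support (by simpa using h0)
    (fun s => s.sum fun _ e => e)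
  have := hf s hs
  unfold totalDegree
  rw [h]
  exact this

theorem mul_mem_W {f p : MvPolynomial (Fin n) 𝕜} {k l : ℕ} (hf : f ∈ W 𝕜 n (k + 1))
    (hp : p ∈ W 𝕜 n l) : f * p ∈ W 𝕜 n (k + l) := by
  by_cases h0 : f * p = 0
  · rw [h0]; exact zero_mem _
  have hf0 : f ≠ 0 := left_ne_zero_of_mul h0
  have hp0 : p ≠ 0 := right_ne_zero_of_mul h0
  refine W_mono ?_ (mem_W_totalDegree _)
  have h1 := totalDegree_lt_of_mem_W hf hf0
  have h2 := totalDegree_lt_of_mem_W hp hp0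
  have h3 := totalDegree_mul_of_isDomain hf0 hp0
  omega

theorem z_mul (i : Fin n) (s : Fin n →₀ ℕ) :
    X i * z 𝕜 n s = z 𝕜 n (Finsupp.single i 1 + s) := by
  simp [z, X, monomial_mul]

theorem lin_ext {M : Type*} [AddCommGroup M] [Module 𝕜 M] {k : ℕ}
    (L L' : MvPolynomial (Fin n) 𝕜 →ₗ[𝕜] M)
    (h : ∀ s : Fin n →₀ ℕ, s.degree < k → L (z 𝕜 n s) = L' (z 𝕜 n s))
    {f : MvPolynomial (Fin n) 𝕜} (hf : f ∈ W 𝕜 n k) : L f = L' f :=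
  W_le (P := LinearMap.eqLocus L L') h hf

/-- linear map with given values on monomials -/
noncomputable def ofMon {M : Type*} [AddCommGroup M] [Module 𝕜 M] (F : (Fin n →₀ ℕ) → M) :
    MvPolynomial (Fin n) 𝕜 →ₗ[𝕜] M :=
  (basisMonomials (Fin n) 𝕜).constr 𝕜 F

theorem ofMon_z {M : Type*} [AddCommGroup M] [Module 𝕜 M] (F : (Fin n →₀ ℕ) → M)
    (s : Fin n →₀ ℕ) : ofMon (𝕜 := 𝕜) F (z 𝕜 n s) = F s := by
  have := (basisMonomials (Fin n) 𝕜).constr_basis 𝕜 F s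
  rwa [coe_basisMonomials] at this

/-- `i` is at most every variable of `s` -/
def Low (i : Fin n) (s : Fin n →₀ ℕ) : Prop := ∀ j ∈ s.support, i ≤ j

theorem low_add {i j : Fin n} {s : Fin n →₀ ℕ} (h : i ≤ j) (hs : Low i s) :
    Low i (Finsupp.single j 1 + s) := by
  intro k hk
  have := Finsupp.support_add hk
  rw [Finset.mem_union] at this
  rcases this with h1 | h1
  · have := Finsupp.support_single_subset h1
    simp at this
    rw [this]; exact h
  · exact hs k h1

/-- a non-low situation exhibits a smaller minimal variable -/
theorem exists_min {i : Fin n} {s : Fin n →₀ ℕ} (h : ¬ Low i s) :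
    ∃ p : Fin n × (Fin n →₀ ℕ), p.1 < i ∧ Low p.1 p.2 ∧ s = Finsupp.single p.1 1 + p.2 := by
  unfold Low at h
  push Not at h
  obtain ⟨j, hj, hji⟩ := h
  have hne : s.support.Nonempty := ⟨j, hj⟩
  refine ⟨(s.support.min' hne, s - Finsupp.single (s.support.min' hne) 1),
    (Finset.min'_le _ _ hj).trans_lt hji, ?_, ?_⟩
  · intro k hk
    apply Finset.min'_le
    exact Finsupp.support_tsub hk
  · symm
    apply add_tsub_cancel_of_le
    rw [Finsupp.single_le_iff]
    have := Finset.min'_mem _ hne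
    rw [Finsupp.mem_support_iff] at this
    show 1 ≤ s (s.support.min' hne)
    omega

theorem low_unique {i j : Fin n} {s t : Fin n →₀ ℕ} (hi : Low i s) (hj : Low j t)
    (h : Finsupp.single i 1 + s = Finsupp.single j 1 + t) : i = j ∧ s = t := by
  have key : ∀ {i j : Fin n} {s t : Fin n →₀ ℕ}, Low i s →
      Finsupp.single i 1 + s = Finsupp.single j 1 + t → i ≤ j := by
    intro i j s t hi h
    have h1 := low_add le_rfl hi
    apply h1
    rw [h]
    simp
  have hij : i = j := le_antisymm (key hi h) (key hj h.symm)
  subst hij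
  exact ⟨rfl, add_left_cancel h⟩

theorem deg_add (i : Fin n) (s : Fin n →₀ ℕ) :
    (Finsupp.single i 1 + s).degree = s.degree + 1 := by
  rw [map_add, Finsupp.degree_single, add_comm]

end Poly

section Act

variable {𝕜 : Type u} [Field 𝕜] {n : ℕ} {g : Type v} [LieRing g] [LieAlgebra 𝕜 g]
  (b : Basis (Fin n) 𝕜 g)

open Classical in
/-- truncated action of basis vectors -/
noncomputable def A : ℕ → Fin n → (MvPolynomial (Fin n) 𝕜 →ₗ[𝕜] MvPolynomial (Fin n) 𝕜)
  | 0 => fun i => ofMon fun s => z 𝕜 n (Finsupp.single i 1 + s)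
  | m + 1 => fun i => ofMon fun s =>
      if s.degree ≤ m then A m i (z 𝕜 n s)
      else if h : Low i s then z 𝕜 n (Finsupp.single i 1 + s)
      else
        z 𝕜 n (Finsupp.single i 1 + s)
        + A m (exists_min h).choose.1 (A m i (z 𝕜 n (exists_min h).choose.2)
            - X i * z 𝕜 n (exists_min h).choose.2)
        + b.constr 𝕜 (A m) ⁅b i, b (exists_min h).choose.1⁆ (z 𝕜 n (exists_min h).choose.2)

theorem A_stab {m : ℕ} {i : Fin n} {s : Fin n →₀ ℕ} (h : s.degree ≤ m) :
    A b m i (z 𝕜 n s) = A b s.degree i (z 𝕜 n s) := by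
  induction m, h using Nat.le_induction with
  | base => rfl
  | succ m hm ih => rw [A, ofMon_z, if_pos hm, ih]

theorem A_low {m : ℕ} {i : Fin n} {s : Fin n →₀ ℕ} (h : Low i s) :
    A b m i (z 𝕜 n s) = z 𝕜 n (Finsupp.single i 1 + s) := by
  induction m with
  | zero => rw [A, ofMon_z]
  | succ m ih =>
    rw [A, ofMon_z]
    split_ifs
    · exact ih
    · rfl

/-- action of basis vectors -/
noncomputable def act (i : Fin n) : MvPolynomial (Fin n) 𝕜 →ₗ[𝕜] MvPolynomial (Fin n) 𝕜 :=
  ofMon fun s => A b s.degree i (z 𝕜 n s)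

theorem A_eq_act {m : ℕ} {i : Fin n} {f : MvPolynomial (Fin n) 𝕜} (hf : f ∈ W 𝕜 n (m + 1)) :
    A b m i f = act b i f := by
  refine lin_ext _ _ (fun s hs => ?_) hf
  rw [act, ofMon_z, A_stab b (Nat.le_of_lt_succ hs)]

theorem act_low {i : Fin n} {s : Fin n →₀ ℕ} (h : Low i s) :
    act b i (z 𝕜 n s) = z 𝕜 n (Finsupp.single i 1 + s) := by
  rw [act, ofMon_z, A_low b h]

/-- action of `g` -/
noncomputable def rho : g →ₗ[𝕜] (MvPolynomial (Fin n) 𝕜 →ₗ[𝕜] MvPolynomial (Fin n) 𝕜) :=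
  b.constr 𝕜 (act b)

theorem rho_b (i : Fin n) : rho b (b i) = act b i := b.constr_basis 𝕜 _ i

theorem constrA {m : ℕ} {x : g} {f : MvPolynomial (Fin n) 𝕜} (hf : f ∈ W 𝕜 n (m + 1)) :
    b.constr 𝕜 (A b m) x f = rho b x f := by
  simp only [rho, Basis.constr_apply_fintype, LinearMap.sum_apply, LinearMap.smul_apply,
    A_eq_act b hf]

theorem act_rec_aux {i j : Fin n} {s : Fin n →₀ ℕ} (hji : j < i) (hj : Low j s)
    (hW : act b i (z 𝕜 n s) - X i * z 𝕜 n s ∈ W 𝕜 n (s.degree + 1)) :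
    act b i (z 𝕜 n (Finsupp.single j 1 + s)) =
      z 𝕜 n (Finsupp.single i 1 + (Finsupp.single j 1 + s))
        + act b j (act b i (z 𝕜 n s) - X i * z 𝕜 n s) + rho b ⁅b i, b j⁆ (z 𝕜 n s) := by
  have hs : z 𝕜 n s ∈ W 𝕜 n (s.degree + 1) := z_mem_W (Nat.lt_succ_self _)
  have hl : ¬ Low i (Finsupp.single j 1 + s) := by
    intro h
    have := h j (by simp)
    exact absurd hji (not_lt.mpr this)
  rw [act, ofMon_z, deg_add, A, ofMon_z, if_neg (by rw [deg_add]; omega), dif_neg hl]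
  have hc := (exists_min hl).choose_spec
  obtain ⟨h1, h2⟩ := low_unique hc.2.1 hj hc.2.2.symm
  rw [h1, h2, A_eq_act b hs, A_eq_act b hW, constrA b hs]
  rfl

theorem rho_mem_of {d : ℕ} (h : ∀ (i : Fin n) (s : Fin n →₀ ℕ), s.degree < d →
    act b i (z 𝕜 n s) - X i * z 𝕜 n s ∈ W 𝕜 n (s.degree + 1)) (x : g)
    {f : MvPolynomial (Fin n) 𝕜} (hf : f ∈ W 𝕜 n d) : rho b x f ∈ W 𝕜 n (d + 1) := by
  refine W_le (P := (W 𝕜 n (d + 1)).comap (rho b x)) (fun s hs => ?_) hf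
  rw [Submodule.mem_comap]
  simp only [rho, Basis.constr_apply_fintype, LinearMap.sum_apply, LinearMap.smul_apply]
  refine Submodule.sum_mem _ fun i _ => Submodule.smul_mem _ _ ?_
  have h1 := W_mono (by omega : s.degree + 1 ≤ d + 1) (h i s hs)
  have h2 : X i * z 𝕜 n s ∈ W 𝕜 n (d + 1) := by
    rw [z_mul]
    exact z_mem_W (by rw [deg_add]; omega)
  have := add_mem h1 h2
  rwa [sub_add_cancel] at this

theorem act_bound_aux (d : ℕ) : ∀ (i : Fin n) (s : Fin n →₀ ℕ), s.degree < d →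
    act b i (z 𝕜 n s) - X i * z 𝕜 n s ∈ W 𝕜 n (s.degree + 1) := by
  induction d with
  | zero => intro i s hs; omega
  | succ d ih =>
    intro i s hs
    by_cases hl : Low i s
    · rw [act_low b hl, z_mul, sub_self]
      exact zero_mem _
    obtain ⟨⟨j, t⟩, hji, hj, rfl⟩ := exists_min hl
    simp only at hji hj hl hs ⊢
    rw [deg_add] at hs ⊢
    have hW := ih i t (by omega)
    have ih' : ∀ (i : Fin n) (s : Fin n →₀ ℕ), s.degree < t.degree + 1 →
      act b i (z 𝕜 n s) - X i * z 𝕜 n s ∈ W 𝕜 n (s.degree + 1) :=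
      fun i s h => ih i s (by omega)
    rw [act_rec_aux b hji hj hW, ← z_mul i (Finsupp.single j 1 + t), add_assoc (X i * _),
      add_sub_cancel_left]
    refine add_mem ?_ ?_
    · rw [← rho_b]
      exact rho_mem_of b ih' _ hW
    · exact rho_mem_of b ih' _ (z_mem_W (Nat.lt_succ_self _))

theorem act_bound (i : Fin n) {k : ℕ} {f : MvPolynomial (Fin n) 𝕜} (hf : f ∈ W 𝕜 n k) :
    act b i f - X i * f ∈ W 𝕜 n k := by
  have h : W 𝕜 n k ≤ (W 𝕜 n k).comap (act b i - LinearMap.mulLeft 𝕜 (X i)) := by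
    refine W_le fun s hs => ?_
    rw [Submodule.mem_comap, LinearMap.sub_apply, LinearMap.mulLeft_apply]
    exact W_mono hs (act_bound_aux b _ i s (Nat.lt_succ_self _))
  have h1 := h hf
  rwa [Submodule.mem_comap, LinearMap.sub_apply, LinearMap.mulLeft_apply] at h1

theorem rho_mem (x : g) {k : ℕ} {f : MvPolynomial (Fin n) 𝕜} (hf : f ∈ W 𝕜 n k) :
    rho b x f ∈ W 𝕜 n (k + 1) :=
  rho_mem_of b (fun i s _ => act_bound_aux b _ i s (Nat.lt_succ_self _)) x hf

/-- commutation in the easy case -/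
theorem comm_low {i j : Fin n} {s : Fin n →₀ ℕ} (hji : j < i) (hj : Low j s) :
    act b i (act b j (z 𝕜 n s)) = act b j (act b i (z 𝕜 n s)) + rho b ⁅b i, b j⁆ (z 𝕜 n s) := by
  rw [act_low b hj, act_rec_aux b hji hj (act_bound_aux b _ i s (Nat.lt_succ_self _)), map_sub,
    z_mul, act_low b (low_add hji.le hj), add_left_comm (Finsupp.single i 1)]
  abel

/-- `rho` respects brackets on polynomials of degree `< k` -/
def Comm (k : ℕ) : Prop := ∀ (x y : g) (f : MvPolynomial (Fin n) 𝕜), f ∈ W 𝕜 n k →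
  rho b x (rho b y f) = rho b y (rho b x f) + rho b ⁅x, y⁆ f

/-- the bracket defect as a bilinear map in the two Lie algebra elements -/
noncomputable def defect (f : MvPolynomial (Fin n) 𝕜) :
    g →ₗ[𝕜] g →ₗ[𝕜] MvPolynomial (Fin n) 𝕜 :=
  LinearMap.mk₂ 𝕜 (fun x y => rho b x (rho b y f) - rho b y (rho b x f) - rho b ⁅x, y⁆ f)
    (by intros; simp only [map_add, LinearMap.add_apply, add_lie]; abel)
    (by intros; simp only [map_smul, LinearMap.smul_apply, smul_lie, smul_sub])
    (by intros; simp only [map_add, LinearMap.add_apply, lie_add]; abel)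
    (by intros; simp only [map_smul, LinearMap.smul_apply, lie_smul, smul_sub])

theorem comm_of_basis {k : ℕ} (h : ∀ (i j : Fin n) (s : Fin n →₀ ℕ), s.degree < k →
    act b i (act b j (z 𝕜 n s)) = act b j (act b i (z 𝕜 n s)) + rho b ⁅b i, b j⁆ (z 𝕜 n s)) :
    Comm b k := by
  intro x y f hf
  have h1 : ∀ s : Fin n →₀ ℕ, s.degree < k → defect b (z 𝕜 n s) = 0 := by
    intro s hs
    refine b.ext fun i => b.ext fun j => ?_
    simp only [defect, LinearMap.mk₂_apply, rho_b, h i j s hs, LinearMap.zero_apply]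
    abel
  refine lin_ext ((rho b x).comp (rho b y)) ((rho b y).comp (rho b x) + rho b ⁅x, y⁆) ?_ hf
  intro s hs
  have h2 := congrArg (fun L => L x y) (h1 s hs)
  simp only [defect, LinearMap.mk₂_apply, LinearMap.zero_apply] at h2
  rw [sub_sub, sub_eq_zero] at h2
  exact h2

theorem comm_step {k : ℕ} (ih : Comm b k) (i j l : Fin n) (s : Fin n →₀ ℕ) (hs : s.degree < k)
    (hl : Low l s) (hli : l < i) (hlj : l < j) :
    act b i (act b j (z 𝕜 n (Finsupp.single l 1 + s))) =
      act b l (act b i (act b j (z 𝕜 n s))) + rho b ⁅b i, b l⁆ (act b j (z 𝕜 n s))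
      + rho b ⁅b j, b l⁆ (act b i (z 𝕜 n s)) + rho b ⁅b i, ⁅b j, b l⁆⁆ (z 𝕜 n s) := by
  have hz : z 𝕜 n s ∈ W 𝕜 n k := z_mem_W hs
  have h1 : act b j (z 𝕜 n (Finsupp.single l 1 + s)) =
      act b l (act b j (z 𝕜 n s)) + rho b ⁅b j, b l⁆ (z 𝕜 n s) := by
    rw [← act_low b hl, comm_low b hlj hl]
  have h2 : act b i (act b l (act b j (z 𝕜 n s))) =
      act b l (act b i (act b j (z 𝕜 n s))) + rho b ⁅b i, b l⁆ (act b j (z 𝕜 n s)) := by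
    have hw := ih (b i) (b l) _ (act_bound b j hz)
    have hc := comm_low b hli (low_add hlj.le hl)
    simp only [rho_b] at hw
    have e : act b j (z 𝕜 n s) = (act b j (z 𝕜 n s) - X j * z 𝕜 n s)
        + z 𝕜 n (Finsupp.single j 1 + s) := by rw [z_mul]; abel
    rw [e]
    simp only [map_add]
    rw [hw, hc]
    abel
  have h3 := ih (b i) ⁅b j, b l⁆ _ hz
  rw [rho_b] at h3
  rw [h1, map_add, h2, h3]
  abel

theorem comm_all (k : ℕ) : Comm b k := by
  induction k with
  | zero => exact comm_of_basis b fun i j s hs => by omega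
  | succ k ih =>
    refine comm_of_basis b ?_
    have key : ∀ (i j : Fin n) (s : Fin n →₀ ℕ), s.degree < k + 1 → j < i →
        act b i (act b j (z 𝕜 n s)) =
          act b j (act b i (z 𝕜 n s)) + rho b ⁅b i, b j⁆ (z 𝕜 n s) := by
      intro i j s hs hji
      by_cases hl : Low j s
      · exact comm_low b hji hl
      obtain ⟨⟨l, t⟩, hlj, hlow, rfl⟩ := exists_min hl
      simp only at hlj hlow hs ⊢
      rw [deg_add] at hs
      have ht : t.degree < k := by omega
      have hz : z 𝕜 n t ∈ W 𝕜 n k := z_mem_W ht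
      rw [comm_step b ih i j l t ht hlow (hlj.trans hji) hlj,
        comm_step b ih j i l t ht hlow hlj (hlj.trans hji)]
      have h1 := ih (b i) (b j) _ hz
      have h2 := ih ⁅b i, b j⁆ (b l) _ hz
      simp only [rho_b] at h1 h2
      rw [← act_low b hlow, h2, h1, lie_lie, map_sub, map_add]
      simp only [LinearMap.sub_apply]
      abel
    intro i j s hs
    rcases lt_trichotomy j i with h | h | h
    · exact key i j s hs h
    · subst h; simp
    · rw [key j i s hs h, ← lie_skew (b i) (b j), map_neg, LinearMap.neg_apply,
        add_neg_cancel_right]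

theorem rho_lie (x y : g) (f : MvPolynomial (Fin n) 𝕜) :
    rho b ⁅x, y⁆ f = rho b x (rho b y f) - rho b y (rho b x f) := by
  rw [comm_all b _ x y f (mem_W_totalDegree f)]
  abel

end Act
end PBW

namespace PBW

open MvPolynomial

section Env

attribute [local instance] LieRing.ofAssociativeRing

variable {𝕜 : Type u} [Field 𝕜] {n : ℕ} {g : Type v} [LieRing g] [LieAlgebra 𝕜 g]
  (b : Basis (Fin n) 𝕜 g)

/-- the canonical map as a linear map -/
noncomputable def inc : g →ₗ[𝕜] UniversalEnvelopingAlgebra 𝕜 g := (UniversalEnvelopingAlgebra.ι 𝕜 : g →ₗ⁅𝕜⁆ UniversalEnvelopingAlgebra 𝕜 g)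

theorem inc_lie (x y : g) :
    inc (𝕜 := 𝕜) ⁅x, y⁆ = inc (𝕜 := 𝕜) x * inc (𝕜 := 𝕜) y - inc (𝕜 := 𝕜) y * inc (𝕜 := 𝕜) x := by
  have := (UniversalEnvelopingAlgebra.ι 𝕜 : g →ₗ⁅𝕜⁆ UniversalEnvelopingAlgebra 𝕜 g).map_lie x y
  rw [LieRing.of_associative_ring_bracket] at this
  exact this

theorem U_induction {P : UniversalEnvelopingAlgebra 𝕜 g → Prop} (hs : ∀ c : 𝕜, P (algebraMap 𝕜 _ c))
    (hi : ∀ x : g, P (inc (𝕜 := 𝕜) x)) (hm : ∀ u v, P u → P v → P (u * v))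
    (ha : ∀ u v, P u → P v → P (u + v)) (u : UniversalEnvelopingAlgebra 𝕜 g) : P u := by
  have hsurj : Function.Surjective (UniversalEnvelopingAlgebra.mkAlgHom 𝕜 g) := by
    intro u
    obtain ⟨t, rfl⟩ := Quotient.exists_rep u
    exact ⟨t, rfl⟩
  obtain ⟨t, rfl⟩ := hsurj u
  induction t using TensorAlgebra.induction with
  | algebraMap r => rw [AlgHom.commutes]; exact hs r
  | ι x => exact hi x
  | mul a c h1 h2 => rw [map_mul]; exact hm _ _ h1 h2
  | add a c h1 h2 => rw [map_add]; exact ha _ _ h1 h2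

/-- `rho` as a Lie algebra morphism -/
noncomputable def rhoLie : g →ₗ⁅𝕜⁆ Module.End 𝕜 (MvPolynomial (Fin n) 𝕜) :=
  { rho b with
    map_lie' := by
      intro x y
      rw [LieRing.of_associative_ring_bracket]
      refine LinearMap.ext fun f => ?_
      exact rho_lie b x y f }

/-- the action of the enveloping algebra -/
noncomputable def R : UniversalEnvelopingAlgebra 𝕜 g →ₐ[𝕜] Module.End 𝕜 (MvPolynomial (Fin n) 𝕜) :=
  UniversalEnvelopingAlgebra.lift 𝕜 (rhoLie b)

theorem R_inc (x : g) (f : MvPolynomial (Fin n) 𝕜) : R b (inc (𝕜 := 𝕜) x) f = rho b x f := by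
  have := UniversalEnvelopingAlgebra.lift_ι_apply 𝕜 (rhoLie b) x
  exact congrArg (fun L => L f) this

/-- evaluation at `1` -/
noncomputable def e : UniversalEnvelopingAlgebra 𝕜 g →ₗ[𝕜] MvPolynomial (Fin n) 𝕜 where
  toFun u := R b u 1
  map_add' u v := by rw [map_add]; rfl
  map_smul' c u := by rw [map_smul]; rfl

theorem e_apply (u : UniversalEnvelopingAlgebra 𝕜 g) : e b u = R b u 1 := rfl

theorem R_mul (u v : UniversalEnvelopingAlgebra 𝕜 g) (f : MvPolynomial (Fin n) 𝕜) : R b (u * v) f = R b u (R b v f) := by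
  rw [map_mul]; rfl

theorem e_mul (u v : UniversalEnvelopingAlgebra 𝕜 g) : e b (u * v) = R b u (e b v) := R_mul b u v 1

open Classical in
/-- ordered monomials in the enveloping algebra -/
noncomputable def sm : ℕ → (Fin n →₀ ℕ) → UniversalEnvelopingAlgebra 𝕜 g
  | 0, _ => 1
  | m + 1, s => if h : ∃ p : Fin n × (Fin n →₀ ℕ), Low p.1 p.2 ∧ s = Finsupp.single p.1 1 + p.2
      then inc (𝕜 := 𝕜) (b h.choose.1) * sm m h.choose.2 else 1

/-- the section `S → U(g)` -/
noncomputable def sec : MvPolynomial (Fin n) 𝕜 →ₗ[𝕜] UniversalEnvelopingAlgebra 𝕜 g := ofMon fun s => sm b s.degree s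

theorem sec_low {i : Fin n} {s : Fin n →₀ ℕ} (h : Low i s) :
    sec b (z 𝕜 n (Finsupp.single i 1 + s)) = inc (𝕜 := 𝕜) (b i) * sec b (z 𝕜 n s) := by
  have hex : ∃ p : Fin n × (Fin n →₀ ℕ), Low p.1 p.2 ∧
      Finsupp.single i 1 + s = Finsupp.single p.1 1 + p.2 := ⟨(i, s), h, rfl⟩
  rw [sec, ofMon_z, ofMon_z, deg_add, sm, dif_pos hex]
  obtain ⟨h1, h2⟩ := low_unique hex.choose_spec.1 h hex.choose_spec.2.symm
  rw [h1, h2]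

theorem z_zero : z 𝕜 n 0 = 1 := rfl

theorem sec_one : sec b 1 = 1 := by
  rw [← z_zero, sec, ofMon_z, map_zero, sm]

theorem low_zero (i : Fin n) : Low i (0 : Fin n →₀ ℕ) := by
  intro j hj; simp at hj

theorem sec_rho_aux (k : ℕ) : ∀ (x : g) (f : MvPolynomial (Fin n) 𝕜), f ∈ W 𝕜 n k →
    sec b (rho b x f) = inc (𝕜 := 𝕜) x * sec b f := by
  have red : ∀ k, (∀ (i : Fin n) (s : Fin n →₀ ℕ), s.degree < k →
      sec b (act b i (z 𝕜 n s)) = inc (𝕜 := 𝕜) (b i) * sec b (z 𝕜 n s)) →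
      ∀ (x : g) (f : MvPolynomial (Fin n) 𝕜), f ∈ W 𝕜 n k →
        sec b (rho b x f) = inc (𝕜 := 𝕜) x * sec b f := by
    intro k h x f hf
    refine lin_ext ((sec b).comp (rho b x)) ((LinearMap.mulLeft 𝕜 (inc (𝕜 := 𝕜) x)).comp (sec b))
      ?_ hf
    intro s hs
    have h2 : (sec b).comp ((rho b).flip (z 𝕜 n s)) =
        (LinearMap.mulRight 𝕜 (sec b (z 𝕜 n s))).comp (inc (𝕜 := 𝕜)) := by
      refine b.ext fun i => ?_
      simp only [LinearMap.comp_apply, LinearMap.flip_apply, rho_b, LinearMap.mulRight_apply]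
      exact h i s hs
    exact congrArg (fun L => L x) h2
  induction k with
  | zero => exact red 0 fun i s hs => by omega
  | succ k ih =>
    refine red _ fun i s hs => ?_
    by_cases hl : Low i s
    · rw [act_low b hl, sec_low b hl]
    obtain ⟨⟨j, t⟩, hji, hlow, rfl⟩ := exists_min hl
    simp only at hji hlow hs hl ⊢
    rw [deg_add] at hs
    have hz : z 𝕜 n t ∈ W 𝕜 n k := z_mem_W (by omega)
    have h1 := ih (b j) _ (act_bound b i hz)
    have h2 := ih (b i) _ hz
    have h3 := ih ⁅b i, b j⁆ _ hz
    have h4 := sec_low b (low_add hji.le hlow)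
    rw [← act_low b (low_add hji.le hlow)] at h4
    simp only [rho_b] at h1 h2
    have e1 : act b i (z 𝕜 n t) = (act b i (z 𝕜 n t) - X i * z 𝕜 n t)
        + z 𝕜 n (Finsupp.single i 1 + t) := by rw [z_mul]; abel
    have h5 : sec b (act b j (act b i (z 𝕜 n t))) =
        inc (𝕜 := 𝕜) (b j) * sec b (act b i (z 𝕜 n t)) := by
      rw [e1]
      simp only [map_add, mul_add]
      rw [h1, h4]
    rw [sec_low b hlow, ← act_low b hlow, comm_low b hji hlow, map_add, h5, h3, h2, inc_lie]
    noncomm_ring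

theorem sec_rho (x : g) (f : MvPolynomial (Fin n) 𝕜) :
    sec b (rho b x f) = inc (𝕜 := 𝕜) x * sec b f :=
  sec_rho_aux b _ x f (mem_W_totalDegree f)

theorem sec_R (u : UniversalEnvelopingAlgebra 𝕜 g) : ∀ f, sec b (R b u f) = u * sec b f := by
  induction u using U_induction with
  | hs c =>
    intro f
    rw [AlgHom.commutes, Module.algebraMap_end_apply, map_smul, Algebra.smul_def]
  | hi x => intro f; rw [R_inc, sec_rho]
  | hm u v h1 h2 => intro f; rw [R_mul, h1, h2, mul_assoc]
  | ha u v h1 h2 => intro f; rw [map_add, LinearMap.add_apply, map_add, h1, h2, add_mul]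

theorem sec_e (u : UniversalEnvelopingAlgebra 𝕜 g) : sec b (e b u) = u := by
  rw [e_apply, sec_R, sec_one, mul_one]

theorem e_sec_z (d : ℕ) : ∀ s : Fin n →₀ ℕ, s.degree = d → e b (sec b (z 𝕜 n s)) = z 𝕜 n s := by
  induction d with
  | zero =>
    intro s hs
    rw [Finsupp.degree_eq_zero_iff] at hs
    subst hs
    rw [z_zero, sec_one, e_apply, map_one (R b)]; rfl
  | succ d ih =>
    intro s hs
    by_cases h : ∃ p : Fin n × (Fin n →₀ ℕ), Low p.1 p.2 ∧ s = Finsupp.single p.1 1 + p.2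
    · obtain ⟨⟨i, t⟩, hl, rfl⟩ := h
      simp only at hl hs ⊢
      rw [deg_add] at hs
      rw [sec_low b hl, e_mul, ih t (by omega), R_inc, rho_b, act_low b hl]
    · exfalso
      have hne : s ≠ 0 := by rintro rfl; simp at hs
      obtain ⟨i, hi⟩ := Finsupp.support_nonempty_iff.mpr hne
      apply h
      by_cases hl : Low i s
      · refine ⟨(i, s - Finsupp.single i 1), fun j hj => hl j (Finsupp.support_tsub hj), ?_⟩
        symm
        apply add_tsub_cancel_of_le
        rw [Finsupp.single_le_iff]
        rw [Finsupp.mem_support_iff] at hi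
        show 1 ≤ s i
        omega
      · obtain ⟨p, _, h1, h2⟩ := exists_min hl
        exact ⟨p, h1, h2⟩

theorem e_sec (f : MvPolynomial (Fin n) 𝕜) : e b (sec b f) = f :=
  lin_ext ((e b).comp (sec b)) LinearMap.id (fun s _ => e_sec_z b _ s rfl) (mem_W_totalDegree f)

/-- PBW as a linear equivalence -/
noncomputable def E : UniversalEnvelopingAlgebra 𝕜 g ≃ₗ[𝕜] MvPolynomial (Fin n) 𝕜 :=
  LinearEquiv.ofLinearMap (e b) (sec b) (LinearMap.ext (e_sec b)) (LinearMap.ext (sec_e b))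

variable (𝕜 g) in
/-- degree at most one part -/
noncomputable def V : Submodule 𝕜 (UniversalEnvelopingAlgebra 𝕜 g) := 1 ⊔ LinearMap.range (inc (𝕜 := 𝕜) (g := g))

theorem V_mono {k l : ℕ} (h : k ≤ l) : V 𝕜 g ^ k ≤ V 𝕜 g ^ l :=
  pow_le_pow_right₀ le_sup_left h

theorem inc_mem_V (x : g) : inc (𝕜 := 𝕜) x ∈ V 𝕜 g :=
  (le_sup_right : LinearMap.range (inc (𝕜 := 𝕜) (g := g)) ≤ V 𝕜 g) ⟨x, rfl⟩

theorem V_ind {k : ℕ} {P : Submodule 𝕜 (UniversalEnvelopingAlgebra 𝕜 g)} (h1 : ∀ u ∈ V 𝕜 g ^ k, u ∈ P)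
    (h2 : ∀ x : g, ∀ u ∈ V 𝕜 g ^ k, inc (𝕜 := 𝕜) x * u ∈ P) : V 𝕜 g ^ (k + 1) ≤ P := by
  rw [pow_succ', V, Submodule.sup_mul, one_mul]
  refine sup_le h1 ?_
  rw [Submodule.mul_le]
  rintro _ ⟨x, rfl⟩ u hu
  exact h2 x u hu

theorem R_mem {d : ℕ} {k : ℕ} {f : MvPolynomial (Fin n) 𝕜} (hf : f ∈ W 𝕜 n k) :
    ∀ u ∈ V 𝕜 g ^ d, R b u f ∈ W 𝕜 n (k + d) := by
  induction d with
  | zero =>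
    intro u hu
    rw [pow_zero, Submodule.mem_one] at hu
    obtain ⟨c, rfl⟩ := hu
    rw [AlgHom.commutes, Module.algebraMap_end_apply]
    exact Submodule.smul_mem _ _ hf
  | succ d ih =>
    intro u hu
    refine V_ind (P := (W 𝕜 n (k + (d + 1))).comap ((LinearMap.applyₗ f).comp (R b).toLinearMap))
      ?_ ?_ hu
    · intro u hu
      exact W_mono (by omega) (ih u hu)
    · intro x u hu
      show R b (inc (𝕜 := 𝕜) x * u) f ∈ W 𝕜 n (k + (d + 1))
      rw [R_mul, R_inc]
      exact rho_mem b x (ih u hu)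

theorem sec_z_mem (d : ℕ) : ∀ s : Fin n →₀ ℕ, sm b d s ∈ V 𝕜 g ^ d := by
  induction d with
  | zero => intro s; rw [sm, pow_zero]; exact Submodule.one_le.mp le_rfl
  | succ d ih =>
    intro s
    rw [sm]
    split_ifs with h
    · rw [pow_succ']
      exact Submodule.mul_mem_mul (inc_mem_V _) (ih _)
    · exact V_mono (Nat.zero_le _) (by rw [pow_zero]; exact Submodule.one_le.mp le_rfl)

theorem mem_V_iff {k : ℕ} {u : UniversalEnvelopingAlgebra 𝕜 g} : u ∈ V 𝕜 g ^ k ↔ e b u ∈ W 𝕜 n (k + 1) := by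
  constructor
  · intro hu
    have := R_mem b (z_mem_W (𝕜 := 𝕜) (n := n) (k := 1) (s := 0) (by simp)) u hu
    rw [add_comm]
    exact this
  · intro hu
    rw [← sec_e b u]
    refine W_le (P := (V 𝕜 g ^ k).comap (sec b)) (fun s hs => ?_) hu
    rw [Submodule.mem_comap, sec, ofMon_z]
    exact V_mono (by omega) (sec_z_mem b _ s)

/-- linear forms attached to elements of `g` -/
noncomputable def lin : g →ₗ[𝕜] MvPolynomial (Fin n) 𝕜 := b.constr 𝕜 X

theorem lin_mem (x : g) : lin b x ∈ W 𝕜 n 2 := by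
  rw [lin, Basis.constr_apply_fintype]
  refine Submodule.sum_mem _ fun i _ => Submodule.smul_mem _ _ ?_
  exact z_mem_W (by rw [Finsupp.degree_single]; omega)

theorem rho_bound (x : g) {k : ℕ} {f : MvPolynomial (Fin n) 𝕜} (hf : f ∈ W 𝕜 n k) :
    rho b x f - lin b x * f ∈ W 𝕜 n k := by
  rw [lin, rho, Basis.constr_apply_fintype, Basis.constr_apply_fintype, LinearMap.sum_apply,
    Finset.sum_mul, ← Finset.sum_sub_distrib]
  refine Submodule.sum_mem _ fun i _ => ?_
  rw [LinearMap.smul_apply, smul_mul_assoc, ← smul_sub]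
  exact Submodule.smul_mem _ _ (act_bound b i hf)

theorem lead {m : ℕ} {f : MvPolynomial (Fin n) 𝕜} (hf : f ∈ W 𝕜 n (m + 1)) (d : ℕ) :
    ∀ u ∈ V 𝕜 g ^ d, R b u f - e b u * f ∈ W 𝕜 n (d + m) := by
  induction d with
  | zero =>
    intro u hu
    rw [pow_zero, Submodule.mem_one] at hu
    obtain ⟨c, rfl⟩ := hu
    rw [e_apply, AlgHom.commutes, Module.algebraMap_end_apply, Module.algebraMap_end_apply,
      smul_mul_assoc, one_mul, sub_self]
    exact zero_mem _
  | succ d ih =>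
    intro u hu
    refine V_ind (P := (W 𝕜 n (d + 1 + m)).comap ((LinearMap.applyₗ f).comp (R b).toLinearMap
      - (LinearMap.mulRight 𝕜 f).comp (e b))) ?_ ?_ hu
    · intro u hu
      exact W_mono (by omega) (ih u hu)
    · intro x u hu
      show R b (inc (𝕜 := 𝕜) x * u) f - e b (inc (𝕜 := 𝕜) x * u) * f ∈ W 𝕜 n (d + 1 + m)
      rw [R_mul, R_inc, e_mul, R_inc]
      have h1 := rho_bound b x (R_mem b hf u hu)
      have h2 := mul_mem_W (lin_mem b x) (ih u hu)
      have h3 := mul_mem_W (rho_bound b x ((mem_V_iff b).mp hu)) hf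
      have e1 : rho b x (R b u f) - rho b x (e b u) * f =
        (rho b x (R b u f) - lin b x * R b u f) + lin b x * (R b u f - e b u * f)
        - (rho b x (e b u) - lin b x * e b u) * f := by ring
      rw [e1]
      refine sub_mem (add_mem ?_ ?_) ?_
      · exact W_mono (by omega) h1
      · exact W_mono (by omega) h2
      · exact W_mono (by omega) h3

theorem mul_ne (b : Basis (Fin n) 𝕜 g) {u v : UniversalEnvelopingAlgebra 𝕜 g} (hu : u ≠ 0) (hv : v ≠ 0) : u * v ≠ 0 := by
  intro h
  have hu' : e b u ≠ 0 := fun h => hu (by rw [← sec_e b u, h, map_zero])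
  have hv' : e b v ≠ 0 := fun h => hv (by rw [← sec_e b v, h, map_zero])
  have h1 := lead b (mem_W_totalDegree (e b v)) _ u ((mem_V_iff b).mpr (mem_W_totalDegree (e b u)))
  rw [← e_mul, h, map_zero, zero_sub] at h1
  have h2 := totalDegree_lt_of_mem_W ((Submodule.neg_mem_iff _).mp h1) (mul_ne_zero hu' hv')
  rw [totalDegree_mul_of_isDomain hu' hv'] at h2
  exact lt_irrefl _ h2

end Env
end PBW

namespace PBW

open MvPolynomial

/-- number of monomials of degree at most `k` in `n` variables -/
def p (n k : ℕ) : ℕ := ∑ j ∈ Finset.range (k + 1), n.multichoose j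

theorem numeric (n m d : ℕ) (hm : 1 ≤ m) : ∃ k, d ≤ m * k ∧ p n (m * k) < p n k + p n (m * k - d) := by
  rcases n with _ | r
  · have h0 : ∀ k, p 0 k = 1 := by
      intro k
      rw [p, Finset.sum_range_succ']
      simp
    refine ⟨d, Nat.le_mul_of_pos_left _ hm, ?_⟩
    simp [h0]
  · set K := d * (r + m) ^ r * (r + 1).factorial with hK
    have hdk : d ≤ m * (K + d) := (Nat.le_add_left d K).trans (Nat.le_mul_of_pos_left _ hm)
    refine ⟨K + d, hdk, ?_⟩
    set k := K + d with hk
    set N := m * k with hN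
    have hb : ∀ j ≤ N, (r + 1).multichoose j ≤ (r + N) ^ r := by
      intro j hj
      rw [Nat.multichoose_eq, show r + 1 + j - 1 = r + j by omega,
        ← Nat.choose_symm_add]
      exact (Nat.choose_le_pow _ _).trans (Nat.pow_le_pow_left (by omega) _)
    have h1 : p (r + 1) N ≤ p (r + 1) (N - d) + d * (r + N) ^ r := by
      unfold p
      rw [← Finset.sum_range_add_sum_Ico _ (by omega : N - d + 1 ≤ N + 1)]
      refine Nat.add_le_add_left ?_ _
      refine (Finset.sum_le_card_nsmul _ _ ((r + N) ^ r) ?_).trans ?_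
      · intro j hj
        rw [Finset.mem_Ico] at hj
        exact hb j (by omega)
      · rw [Nat.card_Ico, smul_eq_mul]
        exact Nat.mul_le_mul_right _ (by omega)
    have h2 : (k + 1) ^ (r + 1) ≤ p (r + 1) k * (r + 1).factorial := by
      unfold p
      rw [Nat.sum_range_multichoose]
      have := Nat.pow_succ_le_ascFactorial (k + 1) (r + 1)
      rw [Nat.ascFactorial_eq_factorial_mul_choose] at this
      rw [mul_comm]
      exact this
    have h3 : d * (r + N) ^ r * (r + 1).factorial < (k + 1) ^ (r + 1) := by
      have h4 : (r + N) ^ r ≤ (r + m) ^ r * (k + 1) ^ r := by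
        rw [← mul_pow]
        refine Nat.pow_le_pow_left ?_ _
        rw [hN]
        nlinarith
      calc d * (r + N) ^ r * (r + 1).factorial
          ≤ d * ((r + m) ^ r * (k + 1) ^ r) * (r + 1).factorial := by gcongr
        _ = K * (k + 1) ^ r := by rw [hK]; ring
        _ < (k + 1) * (k + 1) ^ r := by
            apply Nat.mul_lt_mul_of_pos_right (by omega) (by positivity)
        _ = (k + 1) ^ (r + 1) := by ring
    have h5 : d * (r + N) ^ r < p (r + 1) k := by
      exact lt_of_mul_lt_mul_right (h3.trans_le h2) (Nat.zero_le _)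
    omega

section Fin

variable {𝕜 : Type u} [Field 𝕜] {n : ℕ}

instance finW (k : ℕ) : FiniteDimensional 𝕜 (W 𝕜 n k) := by
  have : Finite {s : Fin n →₀ ℕ | s.degree < k} := (Finsupp.finite_of_degree_lt k).to_subtype
  exact Module.Finite.of_basis (basisRestrictSupport 𝕜 {s : Fin n →₀ ℕ | s.degree < k})

theorem finrank_W (k : ℕ) : finrank 𝕜 (W 𝕜 n (k + 1)) = p n k := by
  have h := Module.finrank_eq_nat_card_basis
    (basisRestrictSupport 𝕜 {s : Fin n →₀ ℕ | s.degree < k + 1})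
  have h2 : ({s : Fin n →₀ ℕ | s.degree < k + 1} : Set (Fin n →₀ ℕ)) =
      ((Finset.range (k + 1)).biUnion (fun j => Finset.finsuppAntidiag Finset.univ j) :
        Finset (Fin n →₀ ℕ)) := by
    ext s
    simp [Finset.mem_finsuppAntidiag, Finsupp.degree_eq_sum]
  change finrank 𝕜 (W 𝕜 n (k + 1)) = _ at h
  rw [Nat.card_coe_set_eq, h2, Set.ncard_coe_finset, Finset.card_biUnion] at h
  · simp only [Finset.card_finsuppAntidiag_nat_eq_multichoose, Finset.card_univ,
      Fintype.card_fin] at h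
    exact h
  · intro i _ j _ hij
    rw [Function.onFun, Finset.disjoint_left]
    intro s hs hs'
    rw [Finset.mem_finsuppAntidiag] at hs hs'
    exact hij (hs.1.symm.trans hs'.1)

variable {g : Type v} [LieRing g] [LieAlgebra 𝕜 g] (b : Basis (Fin n) 𝕜 g)

theorem V_eq_map (k : ℕ) : V 𝕜 g ^ k = (W 𝕜 n (k + 1)).map (E b).symm.toLinearMap := by
  ext u
  rw [mem_V_iff b, Submodule.mem_map]
  constructor
  · intro h
    exact ⟨_, h, sec_e b u⟩
  · rintro ⟨f, hf, rfl⟩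
    have : e b (sec b f) ∈ W 𝕜 n (k + 1) := by rwa [e_sec]
    exact this

theorem finV (b : Basis (Fin n) 𝕜 g) (k : ℕ) : FiniteDimensional 𝕜 ↥(V 𝕜 g ^ k) := by
  rw [V_eq_map b]
  infer_instance

theorem finrank_V (b : Basis (Fin n) 𝕜 g) (k : ℕ) : finrank 𝕜 ↥(V 𝕜 g ^ k) = p n k := by
  rw [V_eq_map b, ← finrank_W (𝕜 := 𝕜)]
  exact LinearEquiv.finrank_map_eq (E b).symm _

theorem exists_mem_V (b : Basis (Fin n) 𝕜 g) (u : UniversalEnvelopingAlgebra 𝕜 g) :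
    ∃ k, u ∈ V 𝕜 g ^ k :=
  ⟨_, (mem_V_iff b).mpr (mem_W_totalDegree _)⟩

end Fin

theorem main {𝕜 : Type u} [Field 𝕜] {n : ℕ}
    {g : Type v} [LieRing g] [LieAlgebra 𝕜 g] (b : Basis (Fin n) 𝕜 g)
    {h : Type w} [LieRing h] [LieAlgebra 𝕜 h] (c : Basis (Fin n) 𝕜 h)
    (Φ : UniversalEnvelopingAlgebra 𝕜 g →ₐ[𝕜] UniversalEnvelopingAlgebra 𝕜 h)
    (hΦ : Function.Surjective Φ) : Function.Injective Φ := by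
  rw [injective_iff_map_eq_zero]
  intro a ha
  by_contra ha0
  obtain ⟨d, hd⟩ := exists_mem_V b a
  have h1 : ∀ i : Fin n, ∃ l : ℕ, inc (𝕜 := 𝕜) (c i) ∈ (V 𝕜 g ^ l).map Φ.toLinearMap := by
    intro i
    obtain ⟨u, hu⟩ := hΦ (inc (𝕜 := 𝕜) (c i))
    obtain ⟨l, hl⟩ := exists_mem_V b u
    exact ⟨l, u, hl, hu⟩
  choose l hl using h1
  set m := Finset.univ.sup l + 1 with hm
  have h2 : V 𝕜 h ≤ (V 𝕜 g ^ m).map Φ.toLinearMap := by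
    refine sup_le ?_ ?_
    · rw [Submodule.one_le]
      exact ⟨1, V_mono (Nat.zero_le m) (by rw [pow_zero]; exact Submodule.one_le.mp le_rfl),
        map_one Φ⟩
    · rw [LinearMap.range_eq_map, ← c.span_eq, Submodule.map_span, Submodule.span_le]
      rintro _ ⟨_, ⟨i, rfl⟩, rfl⟩
      refine Submodule.map_mono (V_mono ?_) (hl i)
      exact (Finset.le_sup (Finset.mem_univ i)).trans (Nat.le_succ _)
  obtain ⟨k, hdk, hk⟩ := numeric n m d (by omega)
  have h3 : V 𝕜 h ^ k ≤ (V 𝕜 g ^ (m * k)).map Φ.toLinearMap := by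
    rw [pow_mul, Submodule.map_pow]
    exact pow_le_pow_left' h2 k
  have : FiniteDimensional 𝕜 ↥(V 𝕜 g ^ (m * k)) := finV b _
  set L := Φ.toLinearMap.domRestrict (V 𝕜 g ^ (m * k)) with hL
  have h4 := L.finrank_range_add_finrank_ker
  rw [finrank_V b] at h4
  have h5 : p n k ≤ finrank 𝕜 (LinearMap.range L) := by
    rw [← finrank_V c, hL, LinearMap.range_domRestrict]
    exact Submodule.finrank_mono h3
  have h6 : p n (m * k - d) ≤ finrank 𝕜 (LinearMap.ker L) := by
    rw [← finrank_V b]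
    have hmem : ∀ u : ↥(V 𝕜 g ^ (m * k - d)), (u : UniversalEnvelopingAlgebra 𝕜 g) * a ∈
        V 𝕜 g ^ (m * k) := by
      intro u
      have := Submodule.mul_mem_mul u.2 hd
      rwa [← pow_add, Nat.sub_add_cancel hdk] at this
    let M : ↥(V 𝕜 g ^ (m * k - d)) →ₗ[𝕜] LinearMap.ker L :=
      LinearMap.codRestrict _ (LinearMap.codRestrict _
        ((LinearMap.mulRight 𝕜 a).comp (Submodule.subtype _)) hmem) (by
          intro u
          rw [LinearMap.mem_ker]
          show Φ ((u : UniversalEnvelopingAlgebra 𝕜 g) * a) = 0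
          rw [map_mul, ha, mul_zero])
    refine LinearMap.finrank_le_finrank_of_injective (f := M) ?_
    rw [injective_iff_map_eq_zero]
    intro u hu
    have h7 : (u : UniversalEnvelopingAlgebra 𝕜 g) * a = 0 :=
      congrArg (fun t => ((t : ↥(V 𝕜 g ^ (m * k))) : UniversalEnvelopingAlgebra 𝕜 g))
        (congrArg Subtype.val hu)
    by_contra hu0
    exact mul_ne b (fun h => hu0 (Subtype.ext h)) ha0 h7
  omega

end PBW

/-- if `g` and `h` are finite-dimensional Lie algebras of the same dimension,
then every surjective algebra homomorphism `U(g) → U(h)` is injective, hence an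
isomorphism. -/
theorem stmt16 (𝕜 : Type u) [Field 𝕜]
    (g : Type v) [LieRing g] [LieAlgebra 𝕜 g] [FiniteDimensional 𝕜 g]
    (h : Type w) [LieRing h] [LieAlgebra 𝕜 h] [FiniteDimensional 𝕜 h]
    (hdim : Module.finrank 𝕜 g = Module.finrank 𝕜 h)
    (Φ : UniversalEnvelopingAlgebra 𝕜 g →ₐ[𝕜] UniversalEnvelopingAlgebra 𝕜 h)
    (hΦ : Function.Surjective Φ) :
    Function.Injective Φ ∧ Function.Bijective Φ := by
  have hi : Function.Injective Φ :=
    PBW.main (Module.finBasisOfFinrankEq 𝕜 g hdim) (Module.finBasis 𝕜 h) Φ hΦ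
  exact ⟨hi, hi, hΦ⟩
end
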